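/- Let F = (f_1,…,f_n) be an O-M system on B and S the common zero set of f_1,…,f_{n-1}. Suppose S ∩ ∂B = {p₁, p₂} with p₁ ≠ p₂. If f_n(p₁)·f_n(p₂) > 0, then F has no zero in B: there is no point p ∈ B with f_1(p) = ⋯ = f_n(p) = 0. -/

import Mathlib

/-- The partial derivative `∂f/∂x_i` at `p`. -/
noncomputable def pd {m : ℕ} (f : (Fin m → ℝ) → ℝ) (i : Fin m) (p : Fin m → ℝ) : ℝ :=
  fderiv ℝ f p (Pi.single i 1)

/-- `f` is continuously differentiable on an open set containing `B`. -/
def C1On {m : ℕ} (f : (Fin m → ℝ) → ℝ) (B : Set (Fin m → ℝ)) : Prop :=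
  ∃ U : Set (Fin m → ℝ), IsOpen U ∧ B ⊆ U ∧ ContDiffOn ℝ 1 f U

/-- `M` is an admissible `i`-minor of the family `g = (g_1, …, g_{n+1})` of
functions on `ℝ^{n+2}` over `B`: there are points `q j ∈ B` with
`M j k = (∂ g_j / ∂ x_{c k})(q j)`, where `c = i.succAbove` is the increasing
enumeration of the complement of `{i}` in `Fin (n+2)`. -/
def AdmMinor (n : ℕ) (g : Fin (n+1) → (Fin (n+2) → ℝ) → ℝ) (B : Set (Fin (n+2) → ℝ))
    (i : Fin (n+2)) (M : Matrix (Fin (n+1)) (Fin (n+1)) ℝ) : Prop :=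
  ∃ q : Fin (n+1) → (Fin (n+2) → ℝ), (∀ j, q j ∈ B) ∧
    ∀ j k, M j k = pd (g j) (i.succAbove k) (q j)

/-- The family `(g_1, …, g_{n+1})` is strongly monotone on `B`: every admissible
`i`-minor over `B` has nonzero determinant, for every `i`. -/
def StrongMono (n : ℕ) (g : Fin (n+1) → (Fin (n+2) → ℝ) → ℝ)
    (B : Set (Fin (n+2) → ℝ)) : Prop :=
  ∀ (i : Fin (n+2)) (M : Matrix (Fin (n+1)) (Fin (n+1)) ℝ), AdmMinor n g B i M → M.det ≠ 0

/-- `F = (f_1,…,f_n)` (with `n = n'+2`, 0-based indices) is an O-M system on `B`: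
(1) the first `n-1` components are strongly monotone on `B`, and (2) for all
indices `i, j`, admissible minors `Mi, Mj` of the first `n-1` components, and
points `p, q ∈ B`, the quantities `(−1)^{i+n}·det Mi·(∂f_n/∂x_i)(p)` and
`(−1)^{j+n}·det Mj·(∂f_n/∂x_j)(q)` have the same (nonzero) sign.  With 0-based
indices the paper's exponent `i+n` becomes `i.val + n' + 1 (mod 2)`. -/
def OMSystem (n : ℕ) (f : Fin (n+2) → (Fin (n+2) → ℝ) → ℝ)
    (B : Set (Fin (n+2) → ℝ)) : Prop :=
  StrongMono n (fun j : Fin (n+1) => f j.castSucc) B ∧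
  ∀ (i j : Fin (n+2)) (Mi Mj : Matrix (Fin (n+1)) (Fin (n+1)) ℝ),
    AdmMinor n (fun j : Fin (n+1) => f j.castSucc) B i Mi →
    AdmMinor n (fun j : Fin (n+1) => f j.castSucc) B j Mj →
    ∀ p q : Fin (n+2) → ℝ, p ∈ B → q ∈ B →
      ((-1 : ℝ) ^ ((i : ℕ) + n + 1) * Mi.det * pd (f (Fin.last (n+1))) i p) *
        ((-1 : ℝ) ^ ((j : ℕ) + n + 1) * Mj.det * pd (f (Fin.last (n+1))) j q) > 0

open Set Filter Topology

theorem fderiv_apply_eq_sum_pd {m : ℕ} (f : (Fin m → ℝ) → ℝ) (x v : Fin m → ℝ) :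
    fderiv ℝ f x v = ∑ i, pd f i x * v i := by
  conv_lhs => rw [pi_eq_sum_univ' v]
  simp [pd, mul_comm]

theorem C1On.contDiffAt {m : ℕ} {f : (Fin m → ℝ) → ℝ} {B : Set (Fin m → ℝ)} (hf : C1On f B)
    {x : Fin m → ℝ} (hx : x ∈ B) : ContDiffAt ℝ 1 f x := by
  obtain ⟨U, hU, hBU, hfU⟩ := hf
  exact hfU.contDiffAt (hU.mem_nhds (hBU hx))

/-- Mean value theorem for a `C¹` function on a convex set, in terms of partial derivatives. -/
theorem C1On.exists_sub_eq_sum_pd {m : ℕ} {f : (Fin m → ℝ) → ℝ} {B : Set (Fin m → ℝ)}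
    (hf : C1On f B) (hB : Convex ℝ B) {x y : Fin m → ℝ} (hx : x ∈ B) (hy : y ∈ B) :
    ∃ q ∈ B, f y - f x = ∑ i, pd f i q * (y i - x i) := by
  obtain ⟨q, hq, h⟩ := domain_mvt (f' := fun z => fderiv ℝ f z)
    (fun z hz => ((hf.contDiffAt hz).differentiableAt
      one_ne_zero).hasFDerivAt.hasFDerivWithinAt) hB hx hy
  exact ⟨q, hB.segment_subset hx hy hq, by simp [h, fderiv_apply_eq_sum_pd]⟩

/-- On a strongly monotone family, the first coordinate parametrizes the common zero set near each
of its interior points. -/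
theorem StrongMono.eventually_exists_zero {n : ℕ} {g : Fin (n+1) → (Fin (n+2) → ℝ) → ℝ}
    {B : Set (Fin (n+2) → ℝ)} (hg : StrongMono n g B) (hC1 : ∀ j, C1On (g j) B)
    {x : Fin (n+2) → ℝ} (hx : x ∈ interior B) (hgx : ∀ j, g j x = 0) :
    ∀ᶠ t in 𝓝 (x 0), ∃ y ∈ B, (∀ j, g j y = 0) ∧ y 0 = t := by
  have hxB := interior_subset hx
  let G : (Fin (n+2) → ℝ) → ℝ × (Fin (n+1) → ℝ) := fun y => (y 0, fun j => g j y)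
  let L : (Fin (n+2) → ℝ) →L[ℝ] ℝ × (Fin (n+1) → ℝ) :=
    (ContinuousLinearMap.proj 0).prod (ContinuousLinearMap.pi fun j => fderiv ℝ (g j) x)
  have hG : HasStrictFDerivAt G L x :=
    (ContinuousLinearMap.proj (R := ℝ) (φ := fun _ : Fin (n+2) => ℝ) 0).hasStrictFDerivAt.prodMk
      (hasStrictFDerivAt_pi.2 fun j =>
        ((hC1 j).contDiffAt hxB).hasStrictFDerivAt one_ne_zero)
  let M : Matrix (Fin (n+1)) (Fin (n+1)) ℝ := fun j k => pd (g j) ((0 : Fin (n+2)).succAbove k) x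
  have hM : M.det ≠ 0 := hg 0 M ⟨fun _ => x, fun _ => hxB, fun _ _ => rfl⟩
  have hinj : Function.Injective L.toLinearMap := by
    refine (injective_iff_map_eq_zero _).2 fun v hv => ?_
    have h0 : v 0 = 0 := congrArg Prod.fst hv
    have hj (j) : fderiv ℝ (g j) x v = 0 := congrFun (congrArg Prod.snd hv) j
    have hMv : M.mulVec (fun k => v k.succ) = 0 := by
      funext j
      simpa [fderiv_apply_eq_sum_pd, Fin.sum_univ_succ, h0, M, Matrix.mulVec, dotProduct]
        using hj j
    have := Matrix.eq_zero_of_mulVec_eq_zero hM hMv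
    funext i
    refine Fin.cases h0 (fun k => congrFun this k) i
  have hsurj : Function.Surjective L.toLinearMap :=
    (LinearMap.injective_iff_surjective_of_finrank_eq_finrank (by simp; ring)).1 hinj
  have hmap := hG.map_nhds_eq_of_surj (LinearMap.range_eq_top.2 hsurj)
  have himg : G '' B ∈ 𝓝 (G x) := hmap ▸ image_mem_map (mem_interior_iff_mem_nhds.1 hx)
  have hGx : G x = (x 0, 0) := Prod.ext rfl (funext hgx)
  have hc : Tendsto (fun t : ℝ => (t, (0 : Fin (n+1) → ℝ))) (𝓝 (x 0)) (𝓝 (G x)) := by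
    rw [hGx]
    exact (Continuous.prodMk_left 0).tendsto _
  filter_upwards [hc himg] with t ⟨y, hy, hyt⟩
  exact ⟨y, hy, fun j => congrFun (congrArg Prod.snd hyt) j, congrArg Prod.fst hyt⟩

/-- On the common zero set of the first components of an O-M system, the last component is
strictly monotone in the first coordinate. -/
theorem OMSystem.sub_mul_sub_mul_pd_pos {n : ℕ} {f : Fin (n+2) → (Fin (n+2) → ℝ) → ℝ}
    {B : Set (Fin (n+2) → ℝ)} (hf : OMSystem n f B) (hB : Convex ℝ B)
    (hC1 : ∀ j, C1On (f j) B) {p x y : Fin (n+2) → ℝ} (hp : p ∈ B) (hx : x ∈ B) (hy : y ∈ B)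
    (hfx : ∀ j : Fin (n+1), f j.castSucc x = 0) (hfy : ∀ j : Fin (n+1), f j.castSucc y = 0)
    (hxy : x ≠ y) :
    0 < (f (Fin.last _) y - f (Fin.last _) x) * (y 0 - x 0) * pd (f (Fin.last _)) 0 p := by
  choose q hqB hq using fun j => (hC1 j).exists_sub_eq_sum_pd hB hx hy
  let J : Matrix (Fin (n+2)) (Fin (n+2)) ℝ := fun j i => pd (f j) i (q j)
  let M (i : Fin (n+2)) : Matrix (Fin (n+1)) (Fin (n+1)) ℝ :=
    J.submatrix (Fin.last _).succAbove i.succAbove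
  have hM (i) : AdmMinor n (fun j : Fin (n+1) => f j.castSucc) B i (M i) :=
    ⟨fun j => q j.castSucc, fun j => hqB _, fun j k => by simp [M, J, Matrix.submatrix]⟩
  set s : Fin (n+2) → ℝ := fun i => (-1) ^ ((i : ℕ) + n + 1) * (M i).det with hs
  have hdet : J.det = ∑ i, s i * pd (f (Fin.last _)) i (q (Fin.last _)) := by
    rw [Matrix.det_succ_row J (Fin.last _)]
    refine Finset.sum_congr rfl fun i _ => ?_
    simp only [hs, M, J, Fin.val_last]
    ring
  have hpos : 0 < s 0 * pd (f (Fin.last _)) 0 p * J.det := by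
    rw [hdet, Finset.mul_sum]
    exact Finset.sum_pos (fun i _ => hf.2 0 i _ _ (hM 0) (hM i) p _ hp (hqB _)) ⟨0, by simp⟩
  have hJ : J.mulVec (y - x) = Pi.single (Fin.last _) (f (Fin.last _) y - f (Fin.last _) x) := by
    funext j
    refine Fin.lastCases ?_ (fun j => ?_) j
    · simp [hq, Matrix.mulVec, dotProduct, J]
    · simpa [hfx, hfy, Matrix.mulVec, dotProduct, J] using (hq j.castSucc).symm
  have hcramer : J.det * (y 0 - x 0) = s 0 * (f (Fin.last _) y - f (Fin.last _) x) := by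
    have h := congrFun (congrArg J.adjugate.mulVec hJ) 0
    rw [Matrix.mulVec_mulVec, Matrix.adjugate_mul] at h
    simpa [Matrix.smul_mulVec, Matrix.adjugate_fin_succ_eq_det_submatrix, hs, M, mul_comm,
      add_comm] using h
  have hJ0 : J.det ≠ 0 := right_ne_zero_of_mul hpos.ne'
  have hs0 : s 0 ≠ 0 := left_ne_zero_of_mul (left_ne_zero_of_mul hpos.ne')
  have hd : y 0 - x 0 ≠ 0 := fun h => by
    have h1 : f (Fin.last _) y - f (Fin.last _) x = 0 := by simpa [h, hs0] using hcramer.symm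
    rw [h1, Pi.single_zero] at hJ
    exact hxy (sub_eq_zero.1 (Matrix.eq_zero_of_mulVec_eq_zero hJ0 hJ)).symm
  have h2 : s 0 ^ 2 * ((f (Fin.last _) y - f (Fin.last _) x) * (y 0 - x 0) *
      pd (f (Fin.last _)) 0 p) = s 0 * pd (f (Fin.last _)) 0 p * J.det * (y 0 - x 0) ^ 2 := by
    linear_combination (-(s 0 * (y 0 - x 0) * pd (f (Fin.last _)) 0 p)) * hcramer
  have h3 : 0 < s 0 * pd (f (Fin.last _)) 0 p * J.det * (y 0 - x 0) ^ 2 := by positivity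
  exact pos_of_mul_pos_right (h2 ▸ h3) (sq_nonneg _)

/-- Nonexistence: if `F` is an O-M system on `B`, the curve `S = V(f_1,…,f_{n-1})`
meets `∂B` in exactly two distinct points `p₁ ≠ p₂`, and `f_n(p₁)·f_n(p₂) > 0`,
then `F` has no zero in `B`. -/
theorem OMSystem.no_zero (n : ℕ) (a b : Fin (n+2) → ℝ)
    (hab : ∀ i, a i < b i) (f : Fin (n+2) → (Fin (n+2) → ℝ) → ℝ)
    (hC1 : ∀ j, C1On (f j) (Set.Icc a b))
    (hOM : OMSystem n f (Set.Icc a b))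
    (p₁ p₂ : Fin (n+2) → ℝ) (hne : p₁ ≠ p₂)
    (hS : {x | ∀ j : Fin (n+1), f j.castSucc x = 0} ∩ frontier (Set.Icc a b) = {p₁, p₂})
    (hsign : f (Fin.last (n+1)) p₁ * f (Fin.last (n+1)) p₂ > 0) :
    ¬ ∃ p : Fin (n+2) → ℝ, p ∈ Set.Icc a b ∧ ∀ j, f j p = 0 := by
  rintro ⟨p, hpB, hp⟩
  set K : Set (Fin (n+2) → ℝ) := {x ∈ Icc a b | ∀ j : Fin (n+1), f j.castSucc x = 0} with hK
  have hKcompact : IsCompact K := by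
    have hKclosed : IsClosed K := by
      have : K = Icc a b ∩ (fun x (j : Fin (n+1)) => f j.castSucc x) ⁻¹' {0} := by
        ext x
        simp [hK, funext_iff]
      rw [this]
      exact ContinuousOn.preimage_isClosed_of_isClosed
        (continuousOn_pi.2 fun j x hx => ((hC1 _).contDiffAt hx).continuousAt.continuousWithinAt)
        isClosed_Icc isClosed_singleton
    exact isCompact_Icc.of_isClosed_subset hKclosed (sep_subset _ _)
  have hpK : p ∈ K := ⟨hpB, fun j => hp _⟩
  have hmem {x} (hx : x ∈ ({p₁, p₂} : Set (Fin (n+2) → ℝ))) : x ∈ K := by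
    rw [← hS] at hx
    exact ⟨isClosed_Icc.frontier_subset hx.2, hx.1⟩
  have hbdry {x} (hx : x ∈ K) (hx' : x ∉ interior (Icc a b)) : x = p₁ ∨ x = p₂ := by
    have : x ∈ ({p₁, p₂} : Set (Fin (n+2) → ℝ)) := by
      rw [← hS, isClosed_Icc.frontier_eq]
      exact ⟨hx.2, hx.1, hx'⟩
    simpa using this
  have hcurve {x} (hx : x ∈ K) (hx' : x ∈ interior (Icc a b)) :
      ∀ᶠ t in 𝓝 (x 0), ∃ y ∈ K, y 0 = t := by
    filter_upwards [hOM.1.eventually_exists_zero (fun j => hC1 _) hx' hx.2] with t ⟨y, hy, hgy, hyt⟩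
    exact ⟨y, ⟨hy, hgy⟩, hyt⟩
  have hmono {x y} (hx : x ∈ K) (hy : y ∈ K) (hxy : x ≠ y) :=
    hOM.sub_mul_sub_mul_pd_pos (convex_Icc a b) hC1 hpB hx.1 hy.1 hx.2 hy.2 hxy
  obtain ⟨u, huK, hu⟩ := hKcompact.exists_isMinOn ⟨p, hpK⟩ (continuous_apply 0).continuousOn
  obtain ⟨v, hvK, hv⟩ := hKcompact.exists_isMaxOn ⟨p, hpK⟩ (continuous_apply 0).continuousOn
  have hub : u = p₁ ∨ u = p₂ := hbdry huK fun h => by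
    obtain ⟨_, ⟨y, hyK, rfl⟩, hlt⟩ :=
      (((hcurve huK h).filter_mono nhdsWithin_le_nhds).and
        (self_mem_nhdsWithin (s := Iio (u 0)))).exists
    exact (hu hyK).not_gt hlt
  have hvb : v = p₁ ∨ v = p₂ := hbdry hvK fun h => by
    obtain ⟨_, ⟨y, hyK, rfl⟩, hlt⟩ :=
      (((hcurve hvK h).filter_mono nhdsWithin_le_nhds).and
        (self_mem_nhdsWithin (s := Ioi (v 0)))).exists
    exact (hv hyK).not_gt hlt
  have huv : u ≠ v := by
    rintro rfl
    have h := hmono (hmem (mem_insert _ _)) (hmem (mem_insert_of_mem _ rfl)) hne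
    have h1 : p₁ 0 = u 0 := (hv (hmem (mem_insert _ _))).antisymm (hu (hmem (mem_insert _ _)))
    have h2 : p₂ 0 = u 0 := (hv (hmem (mem_insert_of_mem _ rfl))).antisymm
      (hu (hmem (mem_insert_of_mem _ rfl)))
    simp [h1, h2] at h
  have hsuv : 0 < f (Fin.last _) u * f (Fin.last _) v := by
    rcases hub with rfl | rfl <;> rcases hvb with rfl | rfl
    · exact absurd rfl huv
    · exact hsign
    · rwa [mul_comm]
    · exact absurd rfl huv
  have hup : u ≠ p := by
    rintro rfl
    simp [hp] at hsuv
  have hpv : p ≠ v := by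
    rintro rfl
    simp [hp] at hsuv
  have h1 := hmono huK hpK hup
  have h2 := hmono hpK hvK hpv
  have hu0 : 0 ≤ p 0 - u 0 := sub_nonneg.2 (hu hpK)
  have hv0 : 0 ≤ v 0 - p 0 := sub_nonneg.2 (hv hpK)
  rw [hp, zero_sub] at h1
  rw [hp, sub_zero] at h2
  have h3 : 0 ≤ (p 0 - u 0) * (v 0 - p 0) * pd (f (Fin.last _)) 0 p ^ 2 *
      (f (Fin.last _) u * f (Fin.last _) v) := by positivity
  nlinarith [mul_pos h1 h2]
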